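/- Let (C, μ) be a flat-foldable MV pattern and consider any exhaustive sequence of crimp operations on C in which every monocrimp is performed at an adjacent pair of remaining creases of opposite μ-value. Then every forcing set of (C, μ) contains every crease of C that survives (i.e., every crease remaining in the final crease pattern, which is an end sequence). -/

import Mathlib

/-- Mountain or valley label for a crease. -/
inductive MV : Type
  | M : MV
  | V : MV
deriving DecidableEq

/-- `(c 0, c 1, …, c n)` is a 1D crease pattern: a strictly increasing finite
sequence of reals with `n ≥ 1`.  The points `c 1, …, c (n-1)` are its creases,
`c 0` and `c n` its ends. -/
def IsCreasePattern (n : ℕ) (c : ℕ → ℝ) : Prop :=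
  1 ≤ n ∧ ∀ i j : ℕ, i < j → j ≤ n → c i < c j

/-- The consecutive creases `(c i, …, c (i+k))` form a crimpable sequence with gap `d`. -/
def IsCrimpable (n : ℕ) (c : ℕ → ℝ) (i k : ℕ) (d : ℝ) : Prop :=
  1 ≤ i ∧ 1 ≤ k ∧ i + k ≤ n - 1 ∧
  (∀ m : ℕ, i ≤ m → m < i + k → c (m + 1) - c m = d) ∧
  d < c i - c (i - 1) ∧ d < c (i + k + 1) - c (i + k)

/-- Additive offset of the folded-position map on the `j`-th interval:
on `[c j, c (j+1)]` the folded-position map is `x ↦ (-1)^j * x + foldOffset c j`. -/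
def foldOffset (c : ℕ → ℝ) : ℕ → ℝ
  | 0 => 0
  | j + 1 => foldOffset c (j) + 2 * (-1 : ℝ) ^ j * c (j + 1)

/-- Folded position of a point `x` belonging to the `j`-th interval `[c j, c (j+1)]`.
This is the unique continuous map equal to the identity on `[c 0, c 1]`, isometric on
every interval, and reversing direction at every crease. -/
def foldPos (c : ℕ → ℝ) (j : ℕ) (x : ℝ) : ℝ := (-1 : ℝ) ^ j * x + foldOffset c j

/-- Folded position of the crease `c i`. -/
def foldCrease (c : ℕ → ℝ) (i : ℕ) : ℝ := foldPos c i (c i)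

/-- `x` lies strictly `lt`-between `a` and `b`. -/
def Between (lt : ℕ → ℕ → Prop) (a b x : ℕ) : Prop :=
  (lt a x ∧ lt x b) ∨ (lt b x ∧ lt x a)

/-- The MV pattern `(C, μ)` is flat-foldable: there is a strict linear order `lt`
("strictly below") on the intervals `I_0, …, I_{n-1}` (indexed `0, …, n-1`) such that:
(i) for each crease `i`, `I_{i-1}` is below `I_i` iff either `μ i = V` and the folded map
is increasing on `I_{i-1}` (slope `(-1)^(i-1) = 1`), or `μ i = M` and it is decreasing;
(ii) for each crease `i` and each interval `J` whose folded image contains the folded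
crease position in its interior, `J` is not strictly between `I_{i-1}` and `I_i`;
(iii) for distinct creases `i, j` folding to the same point, it is not the case that
exactly one of `I_{j-1}`, `I_j` is strictly between `I_{i-1}` and `I_i`. -/
def IsFlatFoldable (n : ℕ) (c : ℕ → ℝ) (μ : ℕ → MV) : Prop :=
  ∃ lt : ℕ → ℕ → Prop,
    (∀ j, j < n → ¬ lt j j) ∧
    (∀ a b e, lt a b → lt b e → lt a e) ∧
    (∀ a b, a < n → b < n → a ≠ b → lt a b ∨ lt b a) ∧
    (∀ a b, lt a b → a < n ∧ b < n) ∧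
    (∀ i, 1 ≤ i → i ≤ n - 1 →
      (lt (i - 1) i ↔ ((μ i = MV.V ∧ Even (i - 1)) ∨ (μ i = MV.M ∧ Odd (i - 1))))) ∧
    (∀ i, 1 ≤ i → i ≤ n - 1 → ∀ j, j < n →
      foldCrease c i ∈
        Set.Ioo (min (foldPos c j (c j)) (foldPos c j (c (j + 1))))
                (max (foldPos c j (c j)) (foldPos c j (c (j + 1)))) →
      ¬ Between lt (i - 1) i j) ∧
    (∀ i j, 1 ≤ i → i ≤ n - 1 → 1 ≤ j → j ≤ n - 1 → i ≠ j →
      foldCrease c i = foldCrease c j →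
      (Between lt (i - 1) i (j - 1) ↔ Between lt (i - 1) i j))

/-- `F` is a forcing set for the MV pattern `(C, μ)`: a set of creases such that the only
flat-foldable assignment agreeing with `μ` on `F` is `μ` itself (on all creases). -/
def IsForcingSet (n : ℕ) (c : ℕ → ℝ) (μ : ℕ → MV) (F : Set ℕ) : Prop :=
  F ⊆ Set.Icc 1 (n - 1) ∧
  ∀ ν : ℕ → MV, IsFlatFoldable n c ν → (∀ x ∈ F, ν x = μ x) →
    ∀ x, 1 ≤ x → x ≤ n - 1 → ν x = μ x

/-- The crease pattern produced by a monocrimp at the adjacent pair `(c j, c (j+1))`: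
it deletes `c j` and `c (j+1)` and translates all later points by `-2 * (c (j+1) - c j)`. -/
def monocrimpPattern (c : ℕ → ℝ) (j : ℕ) : ℕ → ℝ :=
  fun x => if x < j then c x else c (x + 2) - 2 * (c (j + 1) - c j)

/-- A state of the folding process: the set of surviving (alive) indices of the
original crease pattern, together with the current positions of the points.
Creases keep their identity (original index) while their positions shift. -/
structure PState where
  alive : Finset ℕ
  pos : ℕ → ℝ

/-- `a` and `b` are adjacent surviving points (no survivor strictly between them). -/
def Adjacent (s : Finset ℕ) (a b : ℕ) : Prop :=
  a ∈ s ∧ b ∈ s ∧ a < b ∧ ∀ x ∈ s, ¬ (a < x ∧ x < b)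

/-- A monocrimp at the adjacent surviving pair `(a, b)`: the two neighboring intervals
are at least as long as the middle one; `a`, `b` are deleted and all later points are
translated by `-2 * (pos b - pos a)`. -/
def Monocrimp (a b : ℕ) (S T : PState) : Prop :=
  Adjacent S.alive a b ∧
  (∃ l, Adjacent S.alive l a ∧ S.pos b - S.pos a ≤ S.pos a - S.pos l) ∧
  (∃ r, Adjacent S.alive b r ∧ S.pos b - S.pos a ≤ S.pos r - S.pos b) ∧
  T.alive = S.alive \ {a, b} ∧
  T.pos = fun x => if b < x then S.pos x - 2 * (S.pos b - S.pos a) else S.pos x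

/-- The set `α` of surviving creases forms a crimpable sequence with gap `d` in state `S`:
`α` is a set of consecutive survivors, equally spaced at distance `d`, and the intervals
adjacent to its two ends are strictly longer than `d`. -/
def CrimpableIn (S : PState) (α : Finset ℕ) (d : ℝ) : Prop :=
  ∃ lo hi, lo ∈ α ∧ hi ∈ α ∧ (∀ x ∈ α, lo ≤ x ∧ x ≤ hi) ∧ 2 ≤ α.card ∧
    α ⊆ S.alive ∧
    (∀ x ∈ S.alive, lo ≤ x → x ≤ hi → x ∈ α) ∧
    (∀ a b, a ∈ α → b ∈ α → Adjacent S.alive a b → S.pos b - S.pos a = d) ∧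
    (∃ l, Adjacent S.alive l lo ∧ d < S.pos lo - S.pos l) ∧
    (∃ r, Adjacent S.alive hi r ∧ d < S.pos r - S.pos hi)

/-- A monocrimp step performed at an adjacent pair of the remaining creases of `α`. -/
def StepIn (α : Finset ℕ) (S T : PState) : Prop :=
  ∃ a b, a ∈ α ∧ b ∈ α ∧ Monocrimp a b S T

/-- A monocrimp step at an adjacent pair of remaining creases of `α` of opposite μ-value. -/
def StepInMV (μ : ℕ → MV) (α : Finset ℕ) (S T : PState) : Prop :=
  ∃ a b, a ∈ α ∧ b ∈ α ∧ μ a ≠ μ b ∧ Monocrimp a b S T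

/-- A crimp operation on the crimpable sequence `α`: a sequence of monocrimps at adjacent
pairs of the remaining creases of `α` until no crease or exactly one crease of `α` remains. -/
def CrimpOp (α : Finset ℕ) (S T : PState) : Prop :=
  (∃ d, CrimpableIn S α d) ∧
  (∃ (m : ℕ) (W : ℕ → PState), W 0 = S ∧ W m = T ∧ (∀ t, t < m → StepIn α (W t) (W (t + 1)))) ∧
  ((T.alive ∩ α).card ≤ 1)

/-- A crimp operation on `α` in which every monocrimp pair has opposite μ-values. -/
def CrimpOpMV (μ : ℕ → MV) (α : Finset ℕ) (S T : PState) : Prop :=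
  (∃ d, CrimpableIn S α d) ∧
  (∃ (m : ℕ) (W : ℕ → PState), W 0 = S ∧ W m = T ∧ (∀ t, t < m → StepInMV μ α (W t) (W (t + 1)))) ∧
  ((T.alive ∩ α).card ≤ 1)

/-- The initial state of the crease pattern `(c 0, …, c n)`. -/
def initState (n : ℕ) (c : ℕ → ℝ) : PState := ⟨Finset.range (n + 1), c⟩

/-- `S 0, …, S m` is a sequence of crimp operations performed on `(c 0, …, c n)`,
with the `t`-th crimp performed on the crimpable sequence `α t`. -/
def CrimpSeq (n : ℕ) (c : ℕ → ℝ) (m : ℕ) (α : ℕ → Finset ℕ) (S : ℕ → PState) : Prop :=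
  S 0 = initState n c ∧ ∀ t, t < m → CrimpOp (α t) (S t) (S (t + 1))

/-- Same, where every monocrimp is performed at a pair of creases of opposite μ-value. -/
def CrimpSeqMV (μ : ℕ → MV) (n : ℕ) (c : ℕ → ℝ) (m : ℕ)
    (α : ℕ → Finset ℕ) (S : ℕ → PState) : Prop :=
  S 0 = initState n c ∧ ∀ t, t < m → CrimpOpMV μ (α t) (S t) (S (t + 1))

/-- The state contains no crimpable sequence (the sequence of crimps was exhaustive). -/
def Exhausted (S : PState) : Prop := ¬ ∃ α d, CrimpableIn S α d

namespace CrimpFold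

/-- The height `x` lies strictly between the heights `a` and `b`. -/
def HBetween (a b x : ℤ) : Prop := (a < x ∧ x < b) ∨ (b < x ∧ x < a)

lemma hBetween_congr {a b x a' b' x' : ℤ} (h1 : a < x ↔ a' < x') (h2 : x < b ↔ x' < b')
    (h3 : b < x ↔ b' < x') (h4 : x < a ↔ x' < a') : HBetween a b x ↔ HBetween a' b' x' := by
  simp only [HBetween, h1, h2, h3, h4]

/-- The real `x` lies strictly inside the segment with end points `a` and `b`. -/
def Inside (a b x : ℝ) : Prop := (a < x ∧ x < b) ∨ (b < x ∧ x < a)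

/-- The crease `i`, preceded by `p`, has to be folded with the interval starting at `p` below
the interval starting at `i`. -/
def Upward (μ : ℕ → MV) (p i : ℕ) : Prop := (μ i = MV.V ∧ Even p) ∨ (μ i = MV.M ∧ Odd p)

/-- The heights `h` describe a flat folding of the surviving points `s` with folded positions `g`.
Intervals are indexed by their left end points. -/
structure IsFolding (s : Finset ℕ) (g : ℕ → ℝ) (μ : ℕ → MV) (h : ℕ → ℤ) : Prop where
  inj : ∀ a b a' b', Adjacent s a b → Adjacent s a' b' → a ≠ a' → h a ≠ h a'
  label : ∀ p i q, Adjacent s p i → Adjacent s i q → (h p < h i ↔ Upward μ p i)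
  inside : ∀ p i q j k, Adjacent s p i → Adjacent s i q → Adjacent s j k →
    Inside (g j) (g k) (g i) → ¬ HBetween (h p) (h i) (h j)
  cross : ∀ p i q p' j q', Adjacent s p i → Adjacent s i q → Adjacent s p' j → Adjacent s j q' →
    i ≠ j → g i = g j → (HBetween (h p) (h i) (h p') ↔ HBetween (h p) (h i) (h j))

/-- The surviving points are in increasing position, alternate in parity, and are spaced as
their folded positions `g`. -/
def IsCompatible (g : ℕ → ℝ) (S : PState) : Prop :=
  ∀ x y, Adjacent S.alive x y → S.pos x < S.pos y ∧ (Even x ↔ ¬ Even y) ∧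
    (Even x → g y - g x = S.pos y - S.pos x) ∧ (¬ Even x → g x - g y = S.pos y - S.pos x)

section Adjacency

variable {s : Finset ℕ}

lemma adjacent_right_unique {a b b' : ℕ} (h : Adjacent s a b) (h' : Adjacent s a b') :
    b = b' := by
  obtain ⟨_, h2, h3, h4⟩ := h
  obtain ⟨_, k2, k3, k4⟩ := h'
  have := h4 b' k2
  have := k4 b h2
  omega

lemma adjacent_left_unique {a a' b : ℕ} (h : Adjacent s a b) (h' : Adjacent s a' b) :
    a = a' := by
  obtain ⟨h1, _, h3, h4⟩ := h
  obtain ⟨k1, _, k3, k4⟩ := h'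
  have := h4 a' k1
  have := k4 a h1
  omega

lemma exists_adjacent_right {x z : ℕ} (hx : x ∈ s) (hz : z ∈ s) (hxz : x < z) :
    ∃ y, Adjacent s x y ∧ y ≤ z := by
  have hne : (s.filter (x < ·)).Nonempty := ⟨z, by simp [hz, hxz]⟩
  have hm := Finset.min'_mem _ hne
  rw [Finset.mem_filter] at hm
  refine ⟨_, ⟨hx, hm.1, hm.2, fun w hw hlt => ?_⟩, Finset.min'_le _ _ (by simp [hz, hxz])⟩
  have := Finset.min'_le (s.filter (x < ·)) w (by simp [hw, hlt.1])
  omega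

lemma exists_adjacent_left {x z : ℕ} (hx : x ∈ s) (hz : z ∈ s) (hzx : z < x) :
    ∃ y, Adjacent s y x ∧ z ≤ y := by
  have hne : (s.filter (· < x)).Nonempty := ⟨z, by simp [hz, hzx]⟩
  have hm := Finset.max'_mem _ hne
  rw [Finset.mem_filter] at hm
  refine ⟨_, ⟨hm.1, hx, hm.2, fun w hw hlt => ?_⟩, Finset.le_max' _ _ (by simp [hz, hzx])⟩
  have := Finset.le_max' (s.filter (· < x)) w (by simp [hw, hlt.2])
  omega

lemma adjacent_sdiff {l a b r : ℕ} (h1 : Adjacent s l a) (h2 : Adjacent s a b)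
    (h3 : Adjacent s b r) : Adjacent (s \ {a, b}) l r := by
  obtain ⟨p1, p2, p3, p4⟩ := h1
  obtain ⟨q1, q2, q3, q4⟩ := h2
  obtain ⟨t1, t2, t3, t4⟩ := h3
  refine ⟨by simp [p1]; omega, by simp [t2]; omega, by omega, fun x hx hlt => ?_⟩
  simp only [Finset.mem_sdiff, Finset.mem_insert, Finset.mem_singleton] at hx
  have := p4 x hx.1
  have := q4 x hx.1
  have := t4 x hx.1
  omega

lemma adjacent_of_sdiff {l a b r x y : ℕ} (h1 : Adjacent s l a) (h2 : Adjacent s a b)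
    (h3 : Adjacent s b r) (h : Adjacent (s \ {a, b}) x y) :
    (x = l ∧ y = r) ∨ (Adjacent s x y ∧ y ≤ l) ∨ (Adjacent s x y ∧ r ≤ x) := by
  have hlr := adjacent_sdiff h1 h2 h3
  by_cases hx : x = l
  · subst hx
    exact Or.inl ⟨rfl, adjacent_right_unique h hlr⟩
  obtain ⟨k1, k2, k3, k4⟩ := h
  have e1 := k4 l hlr.1
  have e2 := k4 r hlr.2.1
  have e3 := hlr.2.2.2 x k1
  have e4 := hlr.2.2.2 y k2
  have hA : l < r := hlr.2.2.1
  have hl := h1.2.2.1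
  have hm := h2.2.2.1
  have hr := h3.2.2.1
  simp only [Finset.mem_sdiff, Finset.mem_insert, Finset.mem_singleton] at k1 k2 k4
  have key : y ≤ l ∨ r ≤ x := by omega
  have hadj : Adjacent s x y := by
    refine ⟨k1.1, k2.1, k3, fun w hw hlt => k4 w ⟨hw, ?_⟩ hlt⟩
    omega
  tauto

lemma adjacent_cases_sdiff {l a b r x y : ℕ} (h1 : Adjacent s l a) (h2 : Adjacent s a b)
    (h3 : Adjacent s b r) (h : Adjacent s x y) :
    (x = l ∧ y = a) ∨ (x = a ∧ y = b) ∨ (x = b ∧ y = r) ∨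
      (Adjacent (s \ {a, b}) x y ∧ (y ≤ l ∨ r ≤ x)) := by
  by_cases hl : x = l
  · subst hl; exact Or.inl ⟨rfl, adjacent_right_unique h h1⟩
  by_cases ha : x = a
  · subst ha; exact Or.inr (Or.inl ⟨rfl, adjacent_right_unique h h2⟩)
  by_cases hb : x = b
  · subst hb; exact Or.inr (Or.inr (Or.inl ⟨rfl, adjacent_right_unique h h3⟩))
  refine Or.inr (Or.inr (Or.inr ?_))
  have hya : y ≠ a := fun e => hl (adjacent_left_unique h (e ▸ h1))
  have hyb : y ≠ b := fun e => ha (adjacent_left_unique h (e ▸ h2))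
  obtain ⟨k1, k2, k3, k4⟩ := h
  have e1 := h1.2.2.2 x k1
  have e2 := h2.2.2.2 x k1
  have e3 := h3.2.2.2 x k1
  have e4 := k4 l h1.1
  refine ⟨⟨?_, ?_, k3, fun w hw hlt => ?_⟩, by omega⟩
  · simp; tauto
  · simp; tauto
  · exact k4 w (Finset.mem_sdiff.1 hw).1 hlt

lemma adjacent_erase_of_ne {e x y : ℕ} (h : Adjacent s x y) (hx : x ≠ e) (hy : y ≠ e) :
    Adjacent (s.erase e) x y :=
  ⟨Finset.mem_erase.2 ⟨hx, h.1⟩, Finset.mem_erase.2 ⟨hy, h.2.1⟩, h.2.2.1,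
    fun w hw => h.2.2.2 w (Finset.mem_erase.1 hw).2⟩

lemma adjacent_of_erase {e x y : ℕ} (he : (∀ w ∈ s, e ≤ w) ∨ (∀ w ∈ s, w ≤ e))
    (h : Adjacent (s.erase e) x y) : Adjacent s x y := by
  obtain ⟨k1, k2, k3, k4⟩ := h
  simp only [Finset.mem_erase] at k1 k2 k4
  refine ⟨k1.2, k2.2, k3, fun w hw hlt => k4 w ⟨?_, hw⟩ hlt⟩
  rintro rfl
  rcases he with he | he
  · have := he x k1.2; omega
  · have := he y k2.2; omega

end Adjacency

lemma crimpable_of_erase {s : Finset ℕ} {pos : ℕ → ℝ} {e : ℕ} {α : Finset ℕ} {d : ℝ}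
    (he : (∀ w ∈ s, e ≤ w) ∨ (∀ w ∈ s, w ≤ e)) (h : CrimpableIn ⟨s.erase e, pos⟩ α d) :
    CrimpableIn ⟨s, pos⟩ α d := by
  obtain ⟨lo, hi, h1, h2, h3, h4, h5, h6, h7, ⟨l, h8, h9⟩, ⟨r, h10, h11⟩⟩ := h
  refine ⟨lo, hi, h1, h2, h3, h4, h5.trans (Finset.erase_subset _ _), ?_, ?_,
    ⟨l, adjacent_of_erase he h8, h9⟩, ⟨r, adjacent_of_erase he h10, h11⟩⟩
  · intro x hx hlo hhi
    refine h6 x (Finset.mem_erase.2 ⟨?_, hx⟩) hlo hhi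
    rintro rfl
    have a1 := (Finset.mem_erase.1 (h5 h1))
    have a2 := (Finset.mem_erase.1 (h5 h2))
    rcases he with he | he
    · have := he lo a1.2; omega
    · have := he hi a2.2; omega
  · intro a b ha hb hab
    exact h7 a b ha hb (adjacent_erase_of_ne hab (Finset.mem_erase.1 (h5 ha)).1
      (Finset.mem_erase.1 (h5 hb)).1)

section Extension

variable {s : Finset ℕ} {g : ℕ → ℝ} {μ : ℕ → MV}

/-- The three ways a crease can sit relative to the removed pair. -/
lemma crease_cases_sdiff {l a b r p i q : ℕ} (h1 : Adjacent s l a) (h2 : Adjacent s a b)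
    (h3 : Adjacent s b r) (hp : Adjacent s p i) (hq : Adjacent s i q) :
    (p = l ∧ i = a ∧ q = b) ∨ (p = a ∧ i = b ∧ q = r) ∨
    (i = l ∧ p ≠ a ∧ p ≠ b ∧ p ≠ l ∧ Adjacent (s \ {a, b}) p l) ∨
    (p = b ∧ i = r ∧ Adjacent (s \ {a, b}) r q) ∨
    (i ≠ l ∧ i ≠ a ∧ i ≠ b ∧ i ≠ r ∧ p ≠ a ∧ p ≠ b ∧ p ≠ l ∧
      Adjacent (s \ {a, b}) p i ∧ Adjacent (s \ {a, b}) i q) := by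
  have o1 := h1.2.2.1
  have o2 := h2.2.2.1
  have o3 := h3.2.2.1
  have o4 := hp.2.2.1
  have o5 := hq.2.2.1
  rcases adjacent_cases_sdiff h1 h2 h3 hp with ⟨rfl, rfl⟩ | ⟨rfl, rfl⟩ | ⟨rfl, rfl⟩ | ⟨hp', hc⟩
  · exact Or.inl ⟨rfl, rfl, adjacent_right_unique hq h2⟩
  · exact Or.inr (Or.inl ⟨rfl, rfl, adjacent_right_unique hq h3⟩)
  · rcases adjacent_cases_sdiff h1 h2 h3 hq with h | h | h | h
    · omega
    · omega
    · omega
    · exact Or.inr (Or.inr (Or.inr (Or.inl ⟨rfl, rfl, h.1⟩)))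
  · rcases adjacent_cases_sdiff h1 h2 h3 hq with h | h | h | h
    · obtain ⟨rfl, rfl⟩ := h
      exact Or.inr (Or.inr (Or.inl ⟨rfl, by omega, by omega, by omega, hp'⟩))
    · omega
    · omega
    · refine Or.inr (Or.inr (Or.inr (Or.inr ⟨?_, by omega, by omega, ?_, by omega, by omega,
        by omega, hp', h.1⟩)))
      · rintro rfl
        have := adjacent_right_unique h.1 (adjacent_sdiff h1 h2 h3)
        omega
      · rintro rfl
        have := adjacent_left_unique hp' (adjacent_sdiff h1 h2 h3)
        omega

set_option maxHeartbeats 1600000 in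
/-- A flat folding extends over an inverse monocrimp. -/
lemma exists_isFolding_of_sdiff {l a b r : ℕ} (h1 : Adjacent s l a) (h2 : Adjacent s a b)
    (h3 : Adjacent s b r) (hla : Even l ↔ ¬ Even a) (hab : Even a ↔ ¬ Even b) (hμ : μ a ≠ μ b)
    (hg : (g b < g a ∧ g l ≤ g b ∧ g a ≤ g r) ∨ (g a < g b ∧ g b ≤ g l ∧ g r ≤ g a))
    (H : ∃ h, IsFolding (s \ {a, b}) g μ h) : ∃ h, IsFolding s g μ h := by
  classical
  obtain ⟨h, H⟩ := H
  obtain ⟨σ, hσ, hσa⟩ : ∃ σ : ℤ, (σ = 1 ∨ σ = -1) ∧ (0 < σ ↔ Upward μ l a) := by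
    by_cases hu : Upward μ l a
    · exact ⟨1, Or.inl rfl, by simp [hu]⟩
    · exact ⟨-1, Or.inr rfl, by simp [hu]⟩
  have hσb : 0 < σ ↔ Upward μ a b := by
    rw [hσa]
    unfold Upward
    simp only [← Nat.not_even_iff_odd]
    cases e1 : μ a <;> cases e2 : μ b <;> simp_all
  have hbr : ∀ i, Upward μ b i ↔ Upward μ l i := by
    intro i
    unfold Upward
    simp only [← Nat.not_even_iff_odd]
    rw [hla, hab, not_not]
  have o1 := h1.2.2.1
  have o2 := h2.2.2.1
  have o3 := h3.2.2.1
  have hlr := adjacent_sdiff h1 h2 h3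
  set h' : ℕ → ℤ := fun x =>
    if x = a then 3 * h l + σ else if x = b then 3 * h l + 2 * σ else 3 * h x with hdef
  have va : h' a = 3 * h l + σ := by simp [hdef]
  have vb : h' b = 3 * h l + 2 * σ := by simp [hdef, o2.ne']
  have vo : ∀ x, x ≠ a → x ≠ b → h' x = 3 * h x := fun x hx hx' => by simp [hdef, hx, hx']
  have vl : h' l = 3 * h l := vo l (by omega) (by omega)
  have vr : h' r = 3 * h r := vo r (by omega) (by omega)
  have ne : ∀ x y, x ≠ l → Adjacent (s \ {a, b}) x y → h x ≠ h l :=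
    fun x y hx hxy => H.inj x y l r hxy hlr hx
  have hv : ∀ x, h' x = 3 * h l + σ ∨ h' x = 3 * h l + 2 * σ ∨ h' x = 3 * h x := by
    intro x
    by_cases ha : x = a
    · subst ha; exact Or.inl va
    by_cases hb : x = b
    · subst hb; exact Or.inr (Or.inl vb)
    exact Or.inr (Or.inr (vo x ha hb))
  clear_value h'
  refine ⟨h', ⟨?_, ?_, ?_, ?_⟩⟩
  · intro x y x' y' hx hx' hne
    have key : ∀ u v, Adjacent s u v → u = l ∨ u = a ∨ u = b ∨
        (h' u = 3 * h u ∧ h u ≠ h l ∧ Adjacent (s \ {a, b}) u v) := by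
      intro u v huv
      rcases adjacent_cases_sdiff h1 h2 h3 huv with k | k | k | ⟨k, kc⟩
      · exact Or.inl k.1
      · exact Or.inr (Or.inl k.1)
      · exact Or.inr (Or.inr (Or.inl k.1))
      · have := k.2.2.1
        exact Or.inr (Or.inr (Or.inr ⟨vo u (by omega) (by omega), ne u v (by omega) k, k⟩))
    rcases key x y hx with rfl | rfl | rfl | ⟨e1, e2, k⟩ <;>
      rcases key x' y' hx' with rfl | rfl | rfl | ⟨e1', e2', k'⟩
    case inr.inr.inr.inr.inr.inr =>
      have := H.inj _ _ _ _ k k' hne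
      omega
    all_goals clear hσa hσb; omega
  · intro p i q hp hq
    rcases crease_cases_sdiff h1 h2 h3 hp hq with ⟨rfl, rfl, rfl⟩ | ⟨rfl, rfl, rfl⟩ |
      ⟨rfl, n1, n2, n3, k⟩ | ⟨rfl, rfl, k⟩ | ⟨n1, n2, n3, n4, n5, n6, n7, k, k'⟩
    · rw [← hσa]; omega
    · rw [← hσb]; omega
    · rw [← H.label _ _ _ k hlr, vo p n1 n2]; omega
    · rw [hbr, ← H.label _ _ _ hlr k]
      have := ne i q (by omega) k
      omega
    · rw [← H.label _ _ _ k k', vo p n5 n6, vo i n2 n3]; omega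
  · intro p i q j k hp hq hj hin
    unfold Inside at hin
    unfold HBetween
    rcases crease_cases_sdiff h1 h2 h3 hp hq with ⟨rfl, rfl, rfl⟩ | ⟨rfl, rfl, rfl⟩ |
      ⟨rfl, n1, n2, n3, t⟩ | ⟨rfl, rfl, t⟩ | ⟨n1, n2, n3, n4, n5, n6, n7, t, t'⟩
    · have w1 := hv j
      omega
    · have w1 := hv j
      omega
    · have x1 := vo p n1 n2
      have y1 := ne _ _ n3 t
      rcases adjacent_cases_sdiff h1 h2 h3 hj with ⟨rfl, rfl⟩ | ⟨rfl, rfl⟩ | ⟨rfl, rfl⟩ | ⟨u, uc⟩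
      · omega
      · exfalso; grind only
      · exfalso; grind only
      · have w1 := vo j (by have := u.2.2.1; omega) (by have := u.2.2.1; omega)
        have key := H.inside _ _ _ _ _ t hlr u hin
        unfold HBetween at key
        omega
    · have y1 := ne _ _ (by omega) t
      rcases adjacent_cases_sdiff h1 h2 h3 hj with ⟨rfl, rfl⟩ | ⟨rfl, rfl⟩ | ⟨rfl, rfl⟩ | ⟨u, uc⟩
      · exfalso; grind only
      · exfalso; grind only
      · omega
      · have w1 := vo j (by have := u.2.2.1; omega) (by have := u.2.2.1; omega)
        have w2 := ne j k (by have := u.2.2.1; omega) u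
        have key := H.inside _ _ _ _ _ hlr t u hin
        unfold HBetween at key
        omega
    · have x1 := vo p n5 n6
      have x2 := vo i n2 n3
      have y1 := ne _ _ n7 t
      have y2 := ne _ _ n1 t'
      have key : Inside (g l) (g r) (g i) → ¬ HBetween (h p) (h i) (h l) :=
        H.inside _ _ _ _ _ t t' hlr
      unfold Inside HBetween at key
      rcases adjacent_cases_sdiff h1 h2 h3 hj with ⟨rfl, rfl⟩ | ⟨rfl, rfl⟩ | ⟨rfl, rfl⟩ | ⟨u, uc⟩
      · replace key := key (by grind only)
        omega
      · replace key := key (by grind only)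
        omega
      · replace key := key (by grind only)
        omega
      · have w1 := vo j (by have := u.2.2.1; omega) (by have := u.2.2.1; omega)
        have key := H.inside _ _ _ _ _ t t' u hin
        unfold HBetween at key
        omega
  · intro p i q p' j q' hp hq hp' hq' hij hgij
    rcases crease_cases_sdiff h1 h2 h3 hp hq with ⟨rfl, rfl, rfl⟩ | ⟨rfl, rfl, rfl⟩ |
      ⟨rfl, n1, n2, n3, t⟩ | ⟨rfl, rfl, t⟩ | ⟨n1, n2, n3, n4, n5, n6, n7, t, t'⟩
    · have w1 := hv p'
      have w2 := hv j
      unfold HBetween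
      omega
    · have w1 := hv p'
      have w2 := hv j
      unfold HBetween
      omega
    · have x1 := vo p n1 n2
      have y1 := ne _ _ n3 t
      rcases crease_cases_sdiff h1 h2 h3 hp' hq' with ⟨rfl, rfl, rfl⟩ | ⟨rfl, rfl, rfl⟩ |
        ⟨rfl, m1, m2, m3, u⟩ | ⟨rfl, rfl, u⟩ | ⟨m1, m2, m3, m4, m5, m6, m7, u, u'⟩
      · exfalso; rcases hg with hg | hg <;> linarith [hg.1, hg.2.1, hg.2.2]
      · unfold HBetween
        omega
      · unfold HBetween
        omega
      · exfalso; rcases hg with hg | hg <;> linarith [hg.1, hg.2.1, hg.2.2]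
      · have x3 := vo p' m5 m6
        have x4 := vo j m2 m3
        refine (hBetween_congr ?_ ?_ ?_ ?_).trans
          ((H.cross _ _ _ _ _ _ t hlr u u' hij hgij).trans (hBetween_congr ?_ ?_ ?_ ?_).symm) <;> omega
    · have y1 := ne _ _ (by omega) t
      rcases crease_cases_sdiff h1 h2 h3 hp' hq' with ⟨rfl, rfl, rfl⟩ | ⟨rfl, rfl, rfl⟩ |
        ⟨rfl, m1, m2, m3, u⟩ | ⟨rfl, rfl, u⟩ | ⟨m1, m2, m3, m4, m5, m6, m7, u, u'⟩
      · unfold HBetween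
        omega
      · exfalso; rcases hg with hg | hg <;> linarith [hg.1, hg.2.1, hg.2.2]
      · exfalso; rcases hg with hg | hg <;> linarith [hg.1, hg.2.1, hg.2.2]
      · unfold HBetween
        omega
      · have x3 := vo p' m5 m6
        have x4 := vo j m2 m3
        have y3 := ne _ _ m7 u
        have y4 := ne _ _ m1 u'
        refine (hBetween_congr ?_ ?_ ?_ ?_).trans
          ((H.cross _ _ _ _ _ _ hlr t u u' hij hgij).trans (hBetween_congr ?_ ?_ ?_ ?_).symm) <;> omega
    · have x1 := vo p n5 n6
      have x2 := vo i n2 n3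
      have y1 := ne _ _ n7 t
      have y2 := ne _ _ n1 t'
      rcases crease_cases_sdiff h1 h2 h3 hp' hq' with ⟨rfl, rfl, rfl⟩ | ⟨rfl, rfl, rfl⟩ |
        ⟨rfl, m1, m2, m3, u⟩ | ⟨rfl, rfl, u⟩ | ⟨m1, m2, m3, m4, m5, m6, m7, u, u'⟩
      · unfold HBetween
        omega
      · unfold HBetween
        omega
      · have x3 := vo p' m1 m2
        refine (hBetween_congr ?_ ?_ ?_ ?_).trans
          ((H.cross _ _ _ _ _ _ t t' u hlr hij hgij).trans (hBetween_congr ?_ ?_ ?_ ?_).symm) <;> omega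
      · refine (hBetween_congr ?_ ?_ ?_ ?_).trans
          ((H.cross _ _ _ _ _ _ t t' hlr u hij hgij).trans (hBetween_congr ?_ ?_ ?_ ?_).symm) <;> omega
      · have x3 := vo p' m5 m6
        have x4 := vo j m2 m3
        refine (hBetween_congr ?_ ?_ ?_ ?_).trans
          ((H.cross _ _ _ _ _ _ t t' u u' hij hgij).trans (hBetween_congr ?_ ?_ ?_ ?_).symm) <;> omega

/-- A flat folding extends over a first interval that is no longer than its neighbour. -/
lemma exists_isFolding_of_erase_first {e p q : ℕ} (h1 : Adjacent s e p) (h2 : Adjacent s p q)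
    (he : ∀ w ∈ s, e ≤ w)
    (hg : (g e < g p ∧ g q ≤ g e) ∨ (g p < g e ∧ g e ≤ g q))
    (H : ∃ h, IsFolding (s.erase e) g μ h) : ∃ h, IsFolding s g μ h := by
  classical
  obtain ⟨h, H⟩ := H
  obtain ⟨σ, hσ, hσp⟩ : ∃ σ : ℤ, (σ = 1 ∨ σ = -1) ∧ (σ < 0 ↔ Upward μ e p) := by
    by_cases hu : Upward μ e p
    · exact ⟨-1, Or.inr rfl, by simp [hu]⟩
    · exact ⟨1, Or.inl rfl, by simp [hu]⟩
  have o1 := h1.2.2.1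
  have o2 := h2.2.2.1
  set h' : ℕ → ℤ := fun x => if x = e then 2 * h p + σ else 2 * h x with hdef
  have ve : h' e = 2 * h p + σ := by simp [hdef]
  have vo : ∀ x, x ≠ e → h' x = 2 * h x := fun x hx => by simp [hdef, hx]
  have vp : h' p = 2 * h p := vo p o1.ne'
  clear_value h'
  have hpq : Adjacent (s.erase e) p q := adjacent_erase_of_ne h2 (by omega) (by omega)
  have cases1 : ∀ x y, Adjacent s x y → (x = e ∧ y = p) ∨ (x ≠ e ∧ Adjacent (s.erase e) x y) := by
    intro x y hxy
    by_cases hx : x = e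
    · subst hx; exact Or.inl ⟨rfl, adjacent_right_unique hxy h1⟩
    · refine Or.inr ⟨hx, adjacent_erase_of_ne hxy hx ?_⟩
      have := he x hxy.1
      have := hxy.2.2.1
      omega
  have crease : ∀ x i y, Adjacent s x i → Adjacent s i y → (x = e ∧ i = p ∧ y = q) ∨
      (x ≠ e ∧ i ≠ e ∧ i ≠ p ∧ Adjacent (s.erase e) x i ∧ Adjacent (s.erase e) i y) := by
    intro x i y hx hy
    rcases cases1 x i hx with ⟨rfl, rfl⟩ | ⟨hne, k⟩
    · exact Or.inl ⟨rfl, rfl, adjacent_right_unique hy h2⟩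
    · rcases cases1 i y hy with ⟨rfl, rfl⟩ | ⟨hne', k'⟩
      · have := he x hx.1
        have := hx.2.2.1
        omega
      · refine Or.inr ⟨hne, hne', ?_, k, k'⟩
        rintro rfl
        exact hne (adjacent_left_unique hx h1)
  refine ⟨h', ⟨?_, ?_, ?_, ?_⟩⟩
  · intro x y x' y' hx hx' hne
    rcases cases1 x y hx with ⟨rfl, rfl⟩ | ⟨n1, k⟩ <;>
      rcases cases1 x' y' hx' with ⟨rfl, rfl⟩ | ⟨n1', k'⟩
    · omega
    · rw [ve, vo x' n1']; omega
    · rw [ve, vo x n1]; omega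
    · have := H.inj _ _ _ _ k k' hne
      rw [vo x n1, vo x' n1']; omega
  · intro x i y hx hy
    rcases crease x i y hx hy with ⟨rfl, rfl, rfl⟩ | ⟨n1, n2, n3, k, k'⟩
    · rw [← hσp]; omega
    · rw [← H.label _ _ _ k k', vo x n1, vo i n2]; omega
  · intro x i y j k hx hy hj hin
    unfold Inside at hin
    unfold HBetween
    rcases crease x i y hx hy with ⟨rfl, rfl, rfl⟩ | ⟨n1, n2, n3, t, t'⟩ <;>
      rcases cases1 j k hj with ⟨rfl, rfl⟩ | ⟨m1, u⟩
    · omega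
    · rw [ve, vp, vo j m1]; omega
    · rw [ve, vo x n1, vo i n2]
      by_cases hxp : x = k
      · subst hxp
        have := adjacent_right_unique t hpq
        subst this
        exfalso
        grind
      · have a1 := H.inj _ _ _ _ t hpq hxp
        have a2 := H.inj _ _ _ _ t' hpq n3
        have := H.inside _ _ _ _ _ t t' hpq (by unfold Inside; grind)
        unfold HBetween at this
        omega
    · have := H.inside _ _ _ _ _ t t' u hin
      unfold HBetween at this
      rw [vo x n1, vo i n2, vo j m1]
      omega
  · intro x i y x' j y' hx hy hx' hy' hij hgij
    unfold HBetween
    rcases crease x i y hx hy with ⟨rfl, rfl, rfl⟩ | ⟨n1, n2, n3, t, t'⟩ <;>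
      rcases crease x' j y' hx' hy' with ⟨rfl, rfl, rfl⟩ | ⟨m1, m2, m3, u, u'⟩
    · omega
    · rw [ve, vp, vo x' m1, vo j m2]; omega
    · rw [ve, vp, vo x n1, vo i n2]
      by_cases hxp : x = j
      · subst hxp
        have := adjacent_right_unique t hpq
        subst this
        exfalso
        grind
      · have a1 := H.inj _ _ _ _ t hpq hxp
        have a2 := H.inj _ _ _ _ t' hpq n3
        omega
    · have := H.cross _ _ _ _ _ _ t t' u u' hij hgij
      unfold HBetween at this
      rw [vo x n1, vo i n2, vo x' m1, vo j m2]
      omega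

/-- A flat folding extends over a last interval that is no longer than its neighbour. -/
lemma exists_isFolding_of_erase_last {o p e : ℕ} (h1 : Adjacent s o p) (h2 : Adjacent s p e)
    (he : ∀ w ∈ s, w ≤ e)
    (hg : (g p < g e ∧ g e ≤ g o) ∨ (g e < g p ∧ g o ≤ g e))
    (H : ∃ h, IsFolding (s.erase e) g μ h) : ∃ h, IsFolding s g μ h := by
  classical
  obtain ⟨h, H⟩ := H
  obtain ⟨σ, hσ, hσp⟩ : ∃ σ : ℤ, (σ = 1 ∨ σ = -1) ∧ (0 < σ ↔ Upward μ o p) := by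
    by_cases hu : Upward μ o p
    · exact ⟨1, Or.inl rfl, by simp [hu]⟩
    · exact ⟨-1, Or.inr rfl, by simp [hu]⟩
  have o1 := h1.2.2.1
  have o2 := h2.2.2.1
  set h' : ℕ → ℤ := fun x => if x = p then 2 * h o + σ else 2 * h x with hdef
  have vp : h' p = 2 * h o + σ := by simp [hdef]
  have vo : ∀ x, x ≠ p → h' x = 2 * h x := fun x hx => by simp [hdef, hx]
  have voo : h' o = 2 * h o := vo o o1.ne
  clear_value h'
  have hop : Adjacent (s.erase e) o p := adjacent_erase_of_ne h1 (by omega) (by omega)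
  have cases1 : ∀ x y, Adjacent s x y → (x = p ∧ y = e) ∨ (x ≠ p ∧ Adjacent (s.erase e) x y) := by
    intro x y hxy
    by_cases hx : x = p
    · subst hx; exact Or.inl ⟨rfl, adjacent_right_unique hxy h2⟩
    · refine Or.inr ⟨hx, adjacent_erase_of_ne hxy ?_ ?_⟩
      · have := he y hxy.2.1
        have := hxy.2.2.1
        omega
      · rintro rfl
        exact hx (adjacent_left_unique hxy h2)
  have crease : ∀ x i y, Adjacent s x i → Adjacent s i y → (x = o ∧ i = p ∧ y = e) ∨
      (x ≠ p ∧ x ≠ o ∧ i ≠ p ∧ Adjacent (s.erase e) x i ∧ Adjacent (s.erase e) i y) := by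
    intro x i y hx hy
    rcases cases1 i y hy with ⟨rfl, rfl⟩ | ⟨hne, k⟩
    · exact Or.inl ⟨adjacent_left_unique hx h1, rfl, rfl⟩
    · rcases cases1 x i hx with ⟨rfl, rfl⟩ | ⟨hne', k'⟩
      · have := he y hy.2.1
        have := hy.2.2.1
        omega
      · refine Or.inr ⟨hne', ?_, hne, k', k⟩
        rintro rfl
        exact hne (adjacent_right_unique hx h1)
  refine ⟨h', ⟨?_, ?_, ?_, ?_⟩⟩
  · intro x y x' y' hx hx' hne
    rcases cases1 x y hx with ⟨rfl, rfl⟩ | ⟨n1, k⟩ <;>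
      rcases cases1 x' y' hx' with ⟨rfl, rfl⟩ | ⟨n1', k'⟩
    · omega
    · rw [vp, vo x' n1']; omega
    · rw [vp, vo x n1]; omega
    · have := H.inj _ _ _ _ k k' hne
      rw [vo x n1, vo x' n1']; omega
  · intro x i y hx hy
    rcases crease x i y hx hy with ⟨rfl, rfl, rfl⟩ | ⟨n1, n2, n3, k, k'⟩
    · rw [← hσp]; omega
    · rw [← H.label _ _ _ k k', vo x n1, vo i n3]; omega
  · intro x i y j k hx hy hj hin
    unfold Inside at hin
    unfold HBetween
    rcases crease x i y hx hy with ⟨rfl, rfl, rfl⟩ | ⟨n1, n2, n3, t, t'⟩ <;>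
      rcases cases1 j k hj with ⟨rfl, rfl⟩ | ⟨m1, u⟩
    · omega
    · rw [vp, voo, vo j m1]; omega
    · rw [vp, vo x n1, vo i n3]
      by_cases hio : i = o
      · subst hio
        exfalso
        grind
      · have a1 := H.inj _ _ _ _ t hop n2
        have a2 := H.inj _ _ _ _ t' hop hio
        have := H.inside _ _ _ _ _ t t' hop (by unfold Inside; grind)
        unfold HBetween at this
        omega
    · have := H.inside _ _ _ _ _ t t' u hin
      unfold HBetween at this
      rw [vo x n1, vo i n3, vo j m1]
      omega
  · intro x i y x' j y' hx hy hx' hy' hij hgij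
    unfold HBetween
    rcases crease x i y hx hy with ⟨rfl, rfl, rfl⟩ | ⟨n1, n2, n3, t, t'⟩ <;>
      rcases crease x' j y' hx' hy' with ⟨rfl, rfl, rfl⟩ | ⟨m1, m2, m3, u, u'⟩
    · omega
    · rw [vp, voo, vo x' m1, vo j m3]; omega
    · rw [vp, voo, vo x n1, vo i n3]
      by_cases hio : i = x'
      · subst hio
        exfalso
        grind
      · have a1 := H.inj _ _ _ _ t hop n2
        have a2 := H.inj _ _ _ _ t' hop hio
        omega
    · have := H.cross _ _ _ _ _ _ t t' u u' hij hgij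
      unfold HBetween at this
      rw [vo x n1, vo i n3, vo x' m1, vo j m3]
      omega

end Extension

/-- If both extreme intervals are strictly longer than their neighbours, some sequence is
crimpable. -/
lemma exists_crimpable {S : PState} {e p q o p' z : ℕ} (h1 : Adjacent S.alive e p)
    (h2 : Adjacent S.alive p q) (h3 : Adjacent S.alive o p') (h4 : Adjacent S.alive p' z)
    (he : ∀ w ∈ S.alive, e ≤ w) (hz : ∀ w ∈ S.alive, w ≤ z)
    (hfirst : S.pos q - S.pos p < S.pos p - S.pos e)
    (hlast : S.pos p' - S.pos o < S.pos z - S.pos p') : ∃ α d, CrimpableIn S α d := by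
  classical
  obtain ⟨⟨x, y⟩, hxy, hmin⟩ := Finset.exists_min_image
    ((S.alive ×ˢ S.alive).filter fun w => Adjacent S.alive w.1 w.2)
    (fun w => S.pos w.2 - S.pos w.1) ⟨(e, p), by simp [h1, h1.1, h1.2.1]⟩
  simp only [Finset.mem_filter, Finset.mem_product] at hxy hmin
  replace hxy := hxy.2
  set d := S.pos y - S.pos x with hd
  replace hmin : ∀ u v, Adjacent S.alive u v → d ≤ S.pos v - S.pos u :=
    fun u v huv => hmin (u, v) ⟨⟨huv.1, huv.2.1⟩, huv⟩
  have hlo : (S.alive.filter fun u => ∃ v, Adjacent S.alive u v ∧ S.pos v - S.pos u = d).Nonempty :=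
    ⟨x, by simp only [Finset.mem_filter]; exact ⟨hxy.1, y, hxy, rfl⟩⟩
  obtain ⟨lo, hlo_mem, hlo_min⟩ := Finset.exists_min_image _ id hlo
  simp only [Finset.mem_filter, id] at hlo_mem hlo_min
  obtain ⟨hlos, v, hv, hvd⟩ := hlo_mem
  have hlo_lt : lo < p' := by
    have hle : lo ≤ p' := by
      have := hz v hv.2.1
      have := h4.2.2.2 lo hlos
      have := hv.2.2.1
      omega
    refine lt_of_le_of_ne hle ?_
    rintro rfl
    have := adjacent_right_unique hv h4
    subst this
    have := hmin _ _ h3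
    linarith
  have hhi : (S.alive.filter fun u => lo < u ∧
      ∃ v, Adjacent S.alive u v ∧ d < S.pos v - S.pos u).Nonempty := by
    refine ⟨p', ?_⟩
    simp only [Finset.mem_filter]
    have := hmin _ _ h3
    exact ⟨h4.1, hlo_lt, z, h4, by linarith⟩
  obtain ⟨hi, hhi_mem, hhi_min⟩ := Finset.exists_min_image _ id hhi
  simp only [Finset.mem_filter, id] at hhi_mem hhi_min
  obtain ⟨hhis, hlohi, r, hr, hrd⟩ := hhi_mem
  refine ⟨S.alive.filter fun u => lo ≤ u ∧ u ≤ hi, d, lo, hi, ?_, ?_, ?_, ?_, ?_, ?_, ?_, ?_,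
    ⟨r, hr, hrd⟩⟩
  · simp [hlos, hlohi.le]
  · simp [hhis, hlohi.le]
  · intro u hu
    exact (Finset.mem_filter.1 hu).2
  · refine Finset.one_lt_card.2 ⟨lo, ?_, hi, ?_, hlohi.ne⟩
    · simp [hlos, hlohi.le]
    · simp [hhis, hlohi.le]
  · exact Finset.filter_subset _ _
  · intro u hu hu1 hu2
    simp [hu, hu1, hu2]
  · intro a b ha hb hab
    simp only [Finset.mem_filter] at ha hb
    have hlt := hab.2.2.1
    refine le_antisymm ?_ (hmin _ _ hab)
    by_contra hcon
    push Not at hcon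
    rcases ha.2.1.lt_or_eq with hlt' | heq
    · have := hhi_min a ⟨ha.1, hlt', b, hab, hcon⟩
      omega
    · subst heq
      have := adjacent_right_unique hv hab
      subst this
      linarith
  · have helo : e < lo := by
      refine lt_of_le_of_ne (he lo hlos) ?_
      rintro rfl
      have := adjacent_right_unique hv h1
      subst this
      have := hmin _ _ h2
      linarith
    obtain ⟨l, hl, -⟩ := exists_adjacent_left hlos h1.1 helo
    refine ⟨l, hl, lt_of_le_of_ne (hmin _ _ hl) fun heq => ?_⟩
    have := hlo_min l ⟨hl.1, lo, hl, heq.symm⟩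
    have := hl.2.2.1
    omega

lemma isCompatible_erase {g : ℕ → ℝ} {s : Finset ℕ} {pos : ℕ → ℝ} {e : ℕ}
    (he : (∀ w ∈ s, e ≤ w) ∨ (∀ w ∈ s, w ≤ e)) (h : IsCompatible g ⟨s, pos⟩) :
    IsCompatible g ⟨s.erase e, pos⟩ :=
  fun x y hxy => h x y (adjacent_of_erase he hxy)

/-- Every labelling of a pattern without crimpable sequences is flat-foldable. -/
lemma exists_isFolding_of_exhausted {g : ℕ → ℝ} (μ : ℕ → MV) (pos : ℕ → ℝ) (s : Finset ℕ)
    (hc : IsCompatible g ⟨s, pos⟩) (hx : Exhausted ⟨s, pos⟩) : ∃ h, IsFolding s g μ h := by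
  induction hn : s.card generalizing s with
  | zero =>
    rw [Finset.card_eq_zero] at hn
    subst hn
    exact ⟨fun _ => 0, ⟨fun _ _ _ _ h => by simp [Adjacent] at h,
      fun _ _ _ h => by simp [Adjacent] at h, fun _ _ _ _ _ h => by simp [Adjacent] at h,
      fun _ _ _ _ _ _ h => by simp [Adjacent] at h⟩⟩
  | succ N ih =>
    by_cases hcr : ∃ p i q, Adjacent s p i ∧ Adjacent s i q
    · obtain ⟨p₀, i₀, q₀, hp₀, hq₀⟩ := hcr
      have hne : s.Nonempty := ⟨_, hp₀.1⟩
      obtain ⟨e, hes, he⟩ : ∃ e ∈ s, ∀ w ∈ s, e ≤ w :=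
        ⟨s.min' hne, s.min'_mem hne, fun w hw => s.min'_le w hw⟩
      obtain ⟨z, hzs, hz⟩ : ∃ z ∈ s, ∀ w ∈ s, w ≤ z :=
        ⟨s.max' hne, s.max'_mem hne, fun w hw => s.le_max' w hw⟩
      have o1 := he p₀ hp₀.1
      have o2 := hz q₀ hq₀.2.1
      have o3 := hp₀.2.2.1
      have o4 := hq₀.2.2.1
      obtain ⟨p, h1, hpi⟩ := exists_adjacent_right hes hp₀.2.1 (by omega)
      obtain ⟨q, h2, -⟩ := exists_adjacent_right h1.2.1 hzs (by omega)
      obtain ⟨p', h4, hpi'⟩ := exists_adjacent_left hzs hp₀.2.1 (by omega)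
      obtain ⟨o, h3, -⟩ := exists_adjacent_left h4.1 hes (by omega)
      have c1 := hc _ _ h1
      have c2 := hc _ _ h2
      have c3 := hc _ _ h3
      have c4 := hc _ _ h4
      simp only at c1 c2 c3 c4
      by_cases hfirst : pos q - pos p < pos p - pos e
      · by_cases hlast : pos p' - pos o < pos z - pos p'
        · exact absurd (exists_crimpable (S := ⟨s, pos⟩) h1 h2 h3 h4 he hz hfirst hlast) hx
        · refine exists_isFolding_of_erase_last h3 h4 hz ?_ (ih (s.erase z)
            (isCompatible_erase (Or.inr hz) hc)
            (fun ⟨α, d, h⟩ => hx ⟨α, d, crimpable_of_erase (Or.inr hz) h⟩)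
            (by rw [Finset.card_erase_of_mem hzs, hn]; rfl))
          by_cases ev : Even p'
          · have a1 := c4.2.2.1 ev
            have a2 := c3.2.2.2 fun k => c3.2.1.1 k ev
            left; constructor <;> linarith [c4.1, c3.1]
          · have a1 := c4.2.2.2 ev
            have a2 := c3.2.2.1 (c3.2.1.2 ev)
            right; constructor <;> linarith [c4.1, c3.1]
      · refine exists_isFolding_of_erase_first h1 h2 he ?_ (ih (s.erase e)
          (isCompatible_erase (Or.inl he) hc)
          (fun ⟨α, d, h⟩ => hx ⟨α, d, crimpable_of_erase (Or.inl he) h⟩)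
          (by rw [Finset.card_erase_of_mem hes, hn]; rfl))
        by_cases ev : Even e
        · have a1 := c1.2.2.1 ev
          have a2 := c2.2.2.2 (c1.2.1.1 ev)
          left; constructor <;> linarith [c1.1, c2.1]
        · have a1 := c1.2.2.2 ev
          have a2 := c2.2.2.1 (not_not.1 (c1.2.1.not.1 ev))
          right; constructor <;> linarith [c1.1, c2.1]
    · refine ⟨fun x => (x : ℤ), ⟨fun a _ a' _ _ _ hne => by simpa using hne, ?_, ?_, ?_⟩⟩
      · intro p i q hp hq
        exact absurd ⟨p, i, q, hp, hq⟩ hcr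
      · intro p i q _ _ hp hq
        exact absurd ⟨p, i, q, hp, hq⟩ hcr
      · intro p i q _ _ _ hp hq
        exact absurd ⟨p, i, q, hp, hq⟩ hcr

lemma isCompatible_of_monocrimp {g : ℕ → ℝ} {a b : ℕ} {S T : PState} (h : Monocrimp a b S T)
    (hc : IsCompatible g S) : IsCompatible g T := by
  obtain ⟨hab, ⟨l, hl, hle⟩, ⟨r, hr, hre⟩, hT, hpos⟩ := h
  intro x y hxy
  rw [hT] at hxy
  have o1 := hl.2.2.1
  have o2 := hab.2.2.1
  have o3 := hr.2.2.1
  have o4 := hxy.2.2.1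
  rcases adjacent_of_sdiff hl hab hr hxy with ⟨rfl, rfl⟩ | ⟨k, kl⟩ | ⟨k, kr⟩
  · have e1 : T.pos x = S.pos x := by rw [hpos]; exact if_neg (by omega)
    have e2 : T.pos y = S.pos y - 2 * (S.pos b - S.pos a) := by rw [hpos]; exact if_pos o3
    obtain ⟨u1, u2, u3, u4⟩ := hc _ _ hl
    obtain ⟨v1, v2, v3, v4⟩ := hc _ _ hab
    obtain ⟨w1, w2, w3, w4⟩ := hc _ _ hr
    rw [e1, e2]
    refine ⟨by linarith, u2.trans (v2.not.trans (w2.not.not.trans not_not)), fun hev => ?_,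
      fun hev => ?_⟩
    · linarith [u3 hev, v4 (u2.1 hev), w3 (not_not.1 (v2.not.1 (u2.1 hev)))]
    · linarith [u4 hev, v3 (not_not.1 (u2.not.1 hev)), w4 (v2.1 (not_not.1 (u2.not.1 hev)))]
  · have e1 : T.pos x = S.pos x := by rw [hpos]; exact if_neg (by omega)
    have e2 : T.pos y = S.pos y := by rw [hpos]; exact if_neg (by omega)
    rw [e1, e2]
    exact hc _ _ k
  · have e1 : T.pos x = S.pos x - 2 * (S.pos b - S.pos a) := by
      rw [hpos]; exact if_pos (by omega)
    have e2 : T.pos y = S.pos y - 2 * (S.pos b - S.pos a) := by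
      rw [hpos]; exact if_pos (by omega)
    obtain ⟨u1, u2, u3, u4⟩ := hc _ _ k
    rw [e1, e2]
    refine ⟨by linarith, u2, fun hev => ?_, fun hev => ?_⟩
    · linarith [u3 hev]
    · linarith [u4 hev]

lemma exists_isFolding_of_monocrimp {g : ℕ → ℝ} {μ : ℕ → MV} {a b : ℕ} {S T : PState}
    (h : Monocrimp a b S T) (hc : IsCompatible g S) (hμ : μ a ≠ μ b)
    (H : ∃ h, IsFolding T.alive g μ h) : ∃ h, IsFolding S.alive g μ h := by
  obtain ⟨hab, ⟨l, hl, hle⟩, ⟨r, hr, hre⟩, hT, hpos⟩ := h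
  rw [hT] at H
  obtain ⟨u1, u2, u3, u4⟩ := hc _ _ hl
  obtain ⟨v1, v2, v3, v4⟩ := hc _ _ hab
  obtain ⟨w1, w2, w3, w4⟩ := hc _ _ hr
  refine exists_isFolding_of_sdiff hl hab hr u2 v2 hμ ?_ H
  by_cases hev : Even l
  · have := u3 hev
    have := v4 (u2.1 hev)
    have := w3 (not_not.1 (v2.not.1 (u2.1 hev)))
    left; refine ⟨?_, ?_, ?_⟩ <;> linarith
  · have := u4 hev
    have := v3 (not_not.1 (u2.not.1 hev))
    have := w4 (v2.1 (not_not.1 (u2.not.1 hev)))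
    right; refine ⟨?_, ?_, ?_⟩ <;> linarith

/-- A monocrimp at some pair of creases of opposite label. -/
def OppositeStep (μ : ℕ → MV) (S T : PState) : Prop := ∃ a b, μ a ≠ μ b ∧ Monocrimp a b S T

lemma reflTransGen_of_seq {β : Type*} {R : β → β → Prop} (W : ℕ → β) (m : ℕ)
    (h : ∀ t, t < m → Relation.ReflTransGen R (W t) (W (t + 1))) :
    Relation.ReflTransGen R (W 0) (W m) := by
  induction m with
  | zero => exact .refl
  | succ k ih => exact (ih fun t ht => h t (by omega)).trans (h k (by omega))

lemma reflTransGen_of_crimpSeqMV {μ : ℕ → MV} {n : ℕ} {c : ℕ → ℝ} {m : ℕ} {α : ℕ → Finset ℕ}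
    {S : ℕ → PState} (h : CrimpSeqMV μ n c m α S) :
    Relation.ReflTransGen (OppositeStep μ) (initState n c) (S m) := by
  rw [← h.1]
  refine reflTransGen_of_seq S m fun t ht => ?_
  obtain ⟨-, ⟨k, W, h0, hk, hstep⟩, -⟩ := h.2 t ht
  rw [← h0, ← hk]
  refine reflTransGen_of_seq W k fun t ht => .single ?_
  obtain ⟨a, b, -, -, hab, hm⟩ := hstep t ht
  exact ⟨a, b, hab, hm⟩

lemma exists_isFolding_of_reflTransGen {g : ℕ → ℝ} {μ ν : ℕ → MV} {S T : PState}
    (h : Relation.ReflTransGen (OppositeStep μ) S T) (hν : ∀ x ∉ T.alive, ν x = μ x)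
    (hc : IsCompatible g S) :
    T.alive ⊆ S.alive ∧ IsCompatible g T ∧
      ((∃ h, IsFolding T.alive g ν h) → ∃ h, IsFolding S.alive g ν h) := by
  induction h using Relation.ReflTransGen.head_induction_on with
  | refl => exact ⟨subset_rfl, hc, id⟩
  | head hstep _ ih =>
    obtain ⟨a, b, hab, hm⟩ := hstep
    obtain ⟨i1, i2, i3⟩ := ih (isCompatible_of_monocrimp hm hc)
    rw [hm.2.2.2.1] at i1
    refine ⟨i1.trans Finset.sdiff_subset, i2, fun H => ?_⟩
    refine exists_isFolding_of_monocrimp hm hc ?_ (i3 H)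
    rw [hν a fun ha => by simpa using i1 ha, hν b fun hb => by simpa using i1 hb]
    exact hab

lemma adjacent_range {n x y : ℕ} : Adjacent (Finset.range (n + 1)) x y ↔ y = x + 1 ∧ y ≤ n := by
  constructor
  · rintro ⟨h1, h2, h3, h4⟩
    rw [Finset.mem_range] at h1 h2
    have := h4 (x + 1) (by rw [Finset.mem_range]; omega)
    omega
  · rintro ⟨rfl, h⟩
    refine ⟨?_, ?_, by omega, fun _ _ => by omega⟩ <;> rw [Finset.mem_range] <;> omega

lemma foldPos_succ (c : ℕ → ℝ) (j : ℕ) : foldPos c j (c (j + 1)) = foldCrease c (j + 1) := by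
  simp only [foldCrease, foldPos, foldOffset, pow_succ]
  ring

lemma isCompatible_initState {n : ℕ} {c : ℕ → ℝ} (hC : IsCreasePattern n c) :
    IsCompatible (foldCrease c) (initState n c) := by
  intro x y hxy
  obtain ⟨rfl, hy⟩ := adjacent_range.1 hxy
  have key : foldCrease c (x + 1) - foldCrease c x = (-1) ^ x * (c (x + 1) - c x) := by
    rw [← foldPos_succ]
    simp only [foldCrease, foldPos]
    ring
  refine ⟨hC.2 _ _ (by omega) hy, by grind, fun hev => ?_, fun hev => ?_⟩
  · rw [key, hev.neg_one_pow, one_mul]; rfl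
  · rw [Nat.not_even_iff_odd] at hev
    rw [← neg_sub, key, hev.neg_one_pow, neg_one_mul, neg_neg]; rfl

lemma isFlatFoldable_of_isFolding {n : ℕ} {c : ℕ → ℝ} {μ : ℕ → MV} {h : ℕ → ℤ}
    (H : IsFolding (Finset.range (n + 1)) (foldCrease c) μ h) : IsFlatFoldable n c μ := by
  have adj : ∀ x, x < n → Adjacent (Finset.range (n + 1)) x (x + 1) :=
    fun x hx => adjacent_range.2 ⟨rfl, hx⟩
  have btw : ∀ a b x, a < n → b < n → x < n →
      (Between (fun a b => a < n ∧ b < n ∧ h a < h b) a b x ↔ HBetween (h a) (h b) (h x)) := by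
    intro a b x ha hb hx
    simp [Between, HBetween, ha, hb, hx]
  refine ⟨fun a b => a < n ∧ b < n ∧ h a < h b, ?_, ?_, ?_, ?_, ?_, ?_, ?_⟩
  · intro j _ hj
    exact lt_irrefl _ hj.2.2
  · intro a b e h1 h2
    exact ⟨h1.1, h2.2.1, h1.2.2.trans h2.2.2⟩
  · intro a b ha hb hne
    have := H.inj _ _ _ _ (adj a ha) (adj b hb) hne
    rcases lt_or_gt_of_ne this with h | h
    · exact Or.inl ⟨ha, hb, h⟩
    · exact Or.inr ⟨hb, ha, h⟩
  · intro a b hab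
    exact ⟨hab.1, hab.2.1⟩
  · intro i h1 h2
    obtain ⟨i, rfl⟩ := Nat.exists_eq_add_of_le' h1
    have := H.label _ _ _ (adj i (by omega)) (adj (i + 1) (by omega))
    have e1 : i < n := by omega
    have e2 : i + 1 < n := by omega
    simpa [Upward, e1, e2] using this
  · intro i h1 h2 j hj hin
    obtain ⟨i, rfl⟩ := Nat.exists_eq_add_of_le' h1
    rw [btw _ _ _ (by omega) (by omega) hj]
    refine H.inside _ _ _ _ _ (adj i (by omega)) (adj (i + 1) (by omega)) (adj j hj) ?_
    rw [foldPos_succ] at hin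
    change foldCrease c (i + 1) ∈ Set.Ioo (min (foldCrease c j) _) (max (foldCrease c j) _) at hin
    rw [Set.mem_Ioo, min_lt_iff, lt_max_iff] at hin
    unfold Inside
    grind
  · intro i j h1 h2 h3 h4 hij hg
    obtain ⟨i, rfl⟩ := Nat.exists_eq_add_of_le' h1
    obtain ⟨j, rfl⟩ := Nat.exists_eq_add_of_le' h3
    rw [btw _ _ _ (by omega) (by omega) (by omega), btw _ _ _ (by omega) (by omega) (by omega)]
    exact H.cross _ _ _ _ _ _ (adj i (by omega)) (adj (i + 1) (by omega)) (adj j (by omega))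
      (adj (j + 1) (by omega)) hij hg

end CrimpFold

/-- Let `(C, μ)` be flat-foldable, and perform any exhaustive sequence of crimp
operations on `C` in which every monocrimp is performed at an adjacent pair of remaining
creases of opposite μ-value.  Then every forcing set of `(C, μ)` contains every crease
of `C` that survives, i.e. every crease remaining in the final crease pattern (which is
an end sequence). -/
theorem forcing_set_contains_end_creases (n : ℕ) (c : ℕ → ℝ) (μ : ℕ → MV)
    (hC : IsCreasePattern n c) (hF : IsFlatFoldable n c μ)
    (m : ℕ) (α : ℕ → Finset ℕ) (S : ℕ → PState)
    (h : CrimpSeqMV μ n c m α S) (hx : Exhausted (S m))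
    (F : Set ℕ) (hforce : IsForcingSet n c μ F) :
    ∀ x ∈ (S m).alive, 1 ≤ x → x ≤ n - 1 → x ∈ F := by
  intro x hxS hx1 hxn
  by_contra hxF
  obtain ⟨y, hy⟩ : ∃ y, y ≠ μ x := by
    cases μ x
    · exact ⟨MV.V, by simp⟩
    · exact ⟨MV.M, by simp⟩
  have hfold := CrimpFold.exists_isFolding_of_reflTransGen (ν := Function.update μ x y)
    (CrimpFold.reflTransGen_of_crimpSeqMV h)
    (fun w hw => Function.update_of_ne (by rintro rfl; exact hw hxS) _ _)
    (CrimpFold.isCompatible_initState hC)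
  obtain ⟨k, hk⟩ := hfold.2.2
    (CrimpFold.exists_isFolding_of_exhausted _ (S m).pos _ hfold.2.1 hx)
  have := hforce.2 (Function.update μ x y) (CrimpFold.isFlatFoldable_of_isFolding hk)
    (fun w hw => Function.update_of_ne (by rintro rfl; exact hxF hw) _ _) x hx1 hxn
  rw [Function.update_self] at this
  exact hy this
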